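/- arXiv:1802.03191 — 2 statements merged into one kernel-verified Lean document; each statement's English description precedes it below -/
import Mathlib

section
/- Suppose the vector y = (y_S^j) of reals in [0,1] indexed by columns satisfies constraints (1ma), (2ma), (3ma), (4ma) and, in place of (5ma), the strong order constraints in the y-variables: for all i, j ∈ I and every k = 2,…,n, Σ_{columns (S,j') such that S contains a couple (i',k) with r_{i'j'} ≤ r_{ij}} y_S^{j'} + Σ_{columns (S,j') such that S contains a couple (i',k−1) with r_{i'j'} ≥ r_{ij}} y_S^{j'} ≤ 1. Define x_{ij}^k := Σ_{S ∋ (i,k)} y_S^j and ȳ_j := Σ_S y_S^j. Then there exists ŷ ∈ [0,1]^n with ŷ_j ≥ ȳ_j for every j and Σ_{j∈I} ŷ_j = p such that (x, ŷ) satisfies (1fb), (2fb), (in1fb), (3fb), and x satisfies the strong order constraints: for all i, j ∈ I and every k = 2,…,n, Σ_{(i',j') : r_{i'j'} ≤ r_{ij}} x_{i'j'}^k + Σ_{(i',j') : r_{i'j'} ≥ r_{ij}} x_{i'j'}^{k−1} ≤ 1. -/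
open Finset

namespace DOMP

/-- A valid column set: a nonempty set of (client, position) couples containing at most one
couple per client and at most one couple per position. -/
def IsCol (n : ℕ) (S : Finset (Fin n × Fin n)) : Prop :=
  S.Nonempty ∧ (∀ a ∈ S, ∀ b ∈ S, a.1 = b.1 → a = b) ∧
    (∀ a ∈ S, ∀ b ∈ S, a.2 = b.2 → a = b)

instance (n : ℕ) (S : Finset (Fin n × Fin n)) : Decidable (IsCol n S) :=
  @instDecidableAnd _ _ Finset.decidableNonempty
    (@instDecidableAnd _ _ (by infer_instance) (by infer_instance))

/-- Predecessor position (position `k - 1`). -/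
def fpred {n : ℕ} (k : Fin n) : Fin n :=
  ⟨k.val - 1, lt_of_le_of_lt (Nat.sub_le _ _) k.isLt⟩

/-- `x_{ij}^k := ∑_{S ∋ (i,k)} y_S^j` (sum over valid columns). -/
noncomputable def xval (n : ℕ) (y : Finset (Fin n × Fin n) → Fin n → ℝ)
    (i j k : Fin n) : ℝ :=
  ∑ S ∈ univ.filter (fun S : Finset (Fin n × Fin n) => IsCol n S ∧ (i, k) ∈ S), y S j

/-- `y` has entries in `[0,1]` on columns. -/
def YBounds (n : ℕ) (y : Finset (Fin n × Fin n) → Fin n → ℝ) : Prop :=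
  ∀ (S : Finset (Fin n × Fin n)) (j : Fin n), IsCol n S → 0 ≤ y S j ∧ y S j ≤ 1

/-- Constraint (1ma). -/
def C1ma (n : ℕ) (y : Finset (Fin n × Fin n) → Fin n → ℝ) : Prop :=
  ∀ i : Fin n, ∑ j : Fin n,
    ∑ S ∈ univ.filter (fun S : Finset (Fin n × Fin n) =>
      IsCol n S ∧ ∃ k : Fin n, (i, k) ∈ S), y S j = 1

/-- Constraint (2ma). -/
def C2ma (n : ℕ) (y : Finset (Fin n × Fin n) → Fin n → ℝ) : Prop :=
  ∀ k : Fin n, ∑ j : Fin n,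
    ∑ S ∈ univ.filter (fun S : Finset (Fin n × Fin n) =>
      IsCol n S ∧ ∃ i : Fin n, (i, k) ∈ S), y S j = 1

/-- Constraint (3ma). -/
def C3ma (n : ℕ) (y : Finset (Fin n × Fin n) → Fin n → ℝ) : Prop :=
  ∀ j : Fin n, ∑ S ∈ univ.filter (IsCol n), y S j ≤ 1

/-- Constraint (4ma). -/
def C4ma (n p : ℕ) (y : Finset (Fin n × Fin n) → Fin n → ℝ) : Prop :=
  ∑ j : Fin n, ∑ S ∈ univ.filter (IsCol n), y S j ≤ (p : ℝ)

/-- Constraint (5ma): weak order constraints in the `y` variables.  Positions are 0-based,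
so position `k` with `1 ≤ k.val` plays the role of `k = 2, …, n` and `fpred k` that of `k-1`. -/
def C5ma (n : ℕ) (r : Fin n × Fin n → Fin (n * n))
    (y : Finset (Fin n × Fin n) → Fin n → ℝ) : Prop :=
  ∀ k : Fin n, 1 ≤ k.val →
    ∑ i : Fin n, ∑ j : Fin n,
      ((∑ j' : Fin n, ∑ S ∈ univ.filter (fun S : Finset (Fin n × Fin n) =>
          IsCol n S ∧ ∃ i' : Fin n, (i', k) ∈ S ∧ r (i', j') ≤ r (i, j)), y S j') +
       (∑ j' : Fin n, ∑ S ∈ univ.filter (fun S : Finset (Fin n × Fin n) =>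
          IsCol n S ∧ ∃ i' : Fin n, (i', fpred k) ∈ S ∧ r (i, j) ≤ r (i', j')), y S j'))
      ≤ (n : ℝ) ^ 2

/-- Feasibility for the LP relaxation of the set partitioning formulation MP. -/
def MPfeas (n p : ℕ) (r : Fin n × Fin n → Fin (n * n))
    (y : Finset (Fin n × Fin n) → Fin n → ℝ) : Prop :=
  YBounds n y ∧ C1ma n y ∧ C2ma n y ∧ C3ma n y ∧ C4ma n p y ∧ C5ma n r y

/-- Constraint (1fb). -/
def C1fb (n : ℕ) (x : Fin n → Fin n → Fin n → ℝ) : Prop :=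
  ∀ i : Fin n, ∑ j : Fin n, ∑ k : Fin n, x i j k = 1

/-- Constraint (2fb). -/
def C2fb (n : ℕ) (x : Fin n → Fin n → Fin n → ℝ) : Prop :=
  ∀ k : Fin n, ∑ i : Fin n, ∑ j : Fin n, x i j k = 1

/-- Constraint (in1fb). -/
def Cin1fb (n : ℕ) (x : Fin n → Fin n → Fin n → ℝ) (yhat : Fin n → ℝ) : Prop :=
  ∀ i j : Fin n, ∑ k : Fin n, x i j k ≤ yhat j

/-- The weak order constraints in the `x` variables. -/
def WeakOrder (n : ℕ) (r : Fin n × Fin n → Fin (n * n))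
    (x : Fin n → Fin n → Fin n → ℝ) : Prop :=
  ∀ k : Fin n, 1 ≤ k.val →
    ∑ i : Fin n, ∑ j : Fin n,
      ((∑ q ∈ univ.filter (fun q : Fin n × Fin n => r q ≤ r (i, j)), x q.1 q.2 k) +
       (∑ q ∈ univ.filter (fun q : Fin n × Fin n => r (i, j) ≤ r q), x q.1 q.2 (fpred k)))
      ≤ (n : ℝ) ^ 2

/-- Feasibility for the LP relaxation of the formulation WOC. -/
def WOCfeas (n p : ℕ) (r : Fin n × Fin n → Fin (n * n))
    (x : Fin n → Fin n → Fin n → ℝ) (yhat : Fin n → ℝ) : Prop :=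
  (∀ i j k : Fin n, 0 ≤ x i j k ∧ x i j k ≤ 1) ∧
  (∀ j : Fin n, 0 ≤ yhat j ∧ yhat j ≤ 1) ∧
  C1fb n x ∧ C2fb n x ∧ Cin1fb n x yhat ∧
  (∑ j : Fin n, yhat j = (p : ℝ)) ∧ WeakOrder n r x

/-- Cost `c_S^j = ∑_{(i,k) ∈ S} λ^k c_{ij}` of a column. -/
noncomputable def colCost (n : ℕ) (c : Fin n → Fin n → ℝ) (lam : Fin n → ℝ)
    (S : Finset (Fin n × Fin n)) (j : Fin n) : ℝ :=
  ∑ q ∈ S, lam q.2 * c q.1 j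

/-- MP objective `∑_j ∑_S c_S^j y_S^j`. -/
noncomputable def objMP (n : ℕ) (c : Fin n → Fin n → ℝ) (lam : Fin n → ℝ)
    (y : Finset (Fin n × Fin n) → Fin n → ℝ) : ℝ :=
  ∑ j : Fin n, ∑ S ∈ univ.filter (IsCol n), colCost n c lam S j * y S j

/-- WOC objective `∑_i ∑_j ∑_k λ^k c_{ij} x_{ij}^k`. -/
noncomputable def objW (n : ℕ) (c : Fin n → Fin n → ℝ) (lam : Fin n → ℝ)
    (x : Fin n → Fin n → Fin n → ℝ) : ℝ :=
  ∑ i : Fin n, ∑ j : Fin n, ∑ k : Fin n, lam k * c i j * x i j k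

/-- The strong order constraints in the `y` variables. -/
def StrongOrderY (n : ℕ) (r : Fin n × Fin n → Fin (n * n))
    (y : Finset (Fin n × Fin n) → Fin n → ℝ) : Prop :=
  ∀ i j : Fin n, ∀ k : Fin n, 1 ≤ k.val →
    (∑ j' : Fin n, ∑ S ∈ univ.filter (fun S : Finset (Fin n × Fin n) =>
        IsCol n S ∧ ∃ i' : Fin n, (i', k) ∈ S ∧ r (i', j') ≤ r (i, j)), y S j') +
    (∑ j' : Fin n, ∑ S ∈ univ.filter (fun S : Finset (Fin n × Fin n) =>
        IsCol n S ∧ ∃ i' : Fin n, (i', fpred k) ∈ S ∧ r (i, j) ≤ r (i', j')), y S j') ≤ 1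

/-- The strong order constraints in the `x` variables. -/
def StrongOrderX (n : ℕ) (r : Fin n × Fin n → Fin (n * n))
    (x : Fin n → Fin n → Fin n → ℝ) : Prop :=
  ∀ i j : Fin n, ∀ k : Fin n, 1 ≤ k.val →
    (∑ q ∈ univ.filter (fun q : Fin n × Fin n => r q ≤ r (i, j)), x q.1 q.2 k) +
    (∑ q ∈ univ.filter (fun q : Fin n × Fin n => r (i, j) ≤ r q), x q.1 q.2 (fpred k)) ≤ 1

/-- Coefficient `d_{ij}^k` of the pricing subproblem.  Positions are 0-based, so position
`k : Fin n` corresponds to the 1-based position `k.val + 1`; the dual multipliers `ε` are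
indexed 1-based (with the conventions `ε 1 = 0` and `ε (n+1) = 0`). -/
noncomputable def dCoef (n : ℕ) (c : Fin n → Fin n → ℝ) (lam : Fin n → ℝ)
    (r : Fin n × Fin n → Fin (n * n)) (α β : Fin n → ℝ) (ε : ℕ → ℝ)
    (i j k : Fin n) : ℝ :=
  lam k * c i j
    + ((univ.filter (fun q : Fin n × Fin n => r (i, j) ≤ r q)).card : ℝ) * ε (k.val + 1)
    + ((univ.filter (fun q : Fin n × Fin n => r q ≤ r (i, j))).card : ℝ) * ε (k.val + 2)
    - α i - β k

/-- Reduced cost `c̄_S^j` of a column. -/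
noncomputable def redCost (n : ℕ) (c : Fin n → Fin n → ℝ) (lam : Fin n → ℝ)
    (r : Fin n × Fin n → Fin (n * n)) (α β γ : Fin n → ℝ) (δ : ℝ) (ε : ℕ → ℝ)
    (S : Finset (Fin n × Fin n)) (j : Fin n) : ℝ :=
  colCost n c lam S j + γ j + δ
    + ∑ k ∈ univ.filter (fun k : Fin n => 1 ≤ k.val), ∑ i' : Fin n, ∑ j' : Fin n,
        ((∑ q ∈ S.filter (fun q : Fin n × Fin n => q.2 = k ∧ r (q.1, j) ≤ r (i', j')),
            ε (k.val + 1)) +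
         (∑ q ∈ S.filter (fun q : Fin n × Fin n => q.2 = fpred k ∧ r (i', j') ≤ r (q.1, j)),
            ε (k.val + 1)))
    - ∑ q ∈ S, α q.1 - ∑ q ∈ S, β q.2

/-- Cut-modified coefficient `d_{ij}^k` (with dual multipliers `ζ` of the strong order cuts,
indexed 1-based in the position, with conventions `ζ i j 1 = 0` and `ζ i j (n+1) = 0`). -/
noncomputable def dCoefCut (n : ℕ) (c : Fin n → Fin n → ℝ) (lam : Fin n → ℝ)
    (r : Fin n × Fin n → Fin (n * n)) (α β : Fin n → ℝ) (ε : ℕ → ℝ)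
    (ζ : Fin n → Fin n → ℕ → ℝ) (i j k : Fin n) : ℝ :=
  lam k * c i j
    + (∑ q ∈ univ.filter (fun q : Fin n × Fin n => r (i, j) ≤ r q),
        (ε (k.val + 1) + ζ q.1 q.2 (k.val + 1)))
    + (∑ q ∈ univ.filter (fun q : Fin n × Fin n => r q ≤ r (i, j)),
        (ε (k.val + 2) + ζ q.1 q.2 (k.val + 2)))
    - α i - β k

/-- Cut-modified reduced cost `c̄_S^j`. -/
noncomputable def redCostCut (n : ℕ) (c : Fin n → Fin n → ℝ) (lam : Fin n → ℝ)
    (r : Fin n × Fin n → Fin (n * n)) (α β γ : Fin n → ℝ) (δ : ℝ) (ε : ℕ → ℝ)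
    (ζ : Fin n → Fin n → ℕ → ℝ)
    (S : Finset (Fin n × Fin n)) (j : Fin n) : ℝ :=
  colCost n c lam S j + γ j + δ
    + ∑ k ∈ univ.filter (fun k : Fin n => 1 ≤ k.val), ∑ i' : Fin n, ∑ j' : Fin n,
        ((∑ q ∈ S.filter (fun q : Fin n × Fin n => q.2 = k ∧ r (q.1, j) ≤ r (i', j')),
            (ε (k.val + 1) + ζ i' j' (k.val + 1))) +
         (∑ q ∈ S.filter (fun q : Fin n × Fin n => q.2 = fpred k ∧ r (i', j') ≤ r (q.1, j)),
            (ε (k.val + 1) + ζ i' j' (k.val + 1))))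
    - ∑ q ∈ S, α q.1 - ∑ q ∈ S, β q.2

/-- A staircase set: for any two distinct elements, first entries and second entries
compare the same way. -/
def Staircase (S : Finset (ℕ × ℕ)) : Prop :=
  ∀ u ∈ S, ∀ v ∈ S, u ≠ v → (u.1 < v.1 ↔ u.2 < v.2)

/-- The dynamic programming recursion (1-based indices `1, …, n`). -/
def DPrec (n : ℕ) (d g : ℕ → ℕ → ℝ) : Prop :=
  g 1 1 = min 0 (d 1 1) ∧
  (∀ k, 2 ≤ k → k ≤ n → g 1 k = min (d 1 k) (g 1 (k - 1))) ∧
  (∀ l, 2 ≤ l → l ≤ n → g l 1 = min (d l 1) (g (l - 1) 1)) ∧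
  (∀ l k, 2 ≤ l → l ≤ n → 2 ≤ k → k ≤ n →
    g l k = min (min (g (l - 1) (k - 1) + d l k) (g (l - 1) (k - 1)))
                (min (g l (k - 1)) (g (l - 1) k)))

/-- Dual objective `z_D(π)`. -/
noncomputable def zD (n p : ℕ) (α β γ : Fin n → ℝ) (δ : ℝ) (ε : ℕ → ℝ) : ℝ :=
  (∑ i : Fin n, α i) + (∑ k : Fin n, β k) - (∑ j : Fin n, γ j) - (p : ℝ) * δ
    - ∑ m ∈ Finset.Icc 2 n, (n : ℝ) ^ 2 * ε m

/-- Summing over the couples `g t` with `Q t` and then over the columns containing `g t` is summing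
over the columns that contain such a couple, provided each column contains at most one. -/
theorem sum_sum_isCol_mem {n : ℕ} {ι : Type*} [Fintype ι] (f : Finset (Fin n × Fin n) → ℝ)
    (g : ι → Fin n × Fin n) (Q : ι → Prop) [DecidablePred Q]
    [DecidablePred fun S : Finset (Fin n × Fin n) => IsCol n S ∧ ∃ t, g t ∈ S ∧ Q t]
    (hg : ∀ S, IsCol n S → ∀ t t', g t ∈ S → g t' ∈ S → t = t') :
    ∑ t ∈ univ.filter Q,
        ∑ S ∈ univ.filter (fun S : Finset (Fin n × Fin n) => IsCol n S ∧ g t ∈ S), f S =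
      ∑ S ∈ univ.filter (fun S : Finset (Fin n × Fin n) => IsCol n S ∧ ∃ t, g t ∈ S ∧ Q t),
        f S := by
  classical
  rw [← sum_biUnion]
  · refine sum_congr ?_ fun _ _ => rfl
    ext S
    simp only [mem_biUnion, mem_filter, mem_univ, true_and]
    grind
  · intro t _ t' _ htt'
    rw [Function.onFun, disjoint_left]
    intro S hS hS'
    simp only [mem_filter, mem_univ, true_and] at hS hS'
    exact htt' (hg S hS.1 t t' hS.2 hS'.2)

theorem IsCol.eq_of_mem_client {n : ℕ} {S : Finset (Fin n × Fin n)} (hS : IsCol n S)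
    {i k k' : Fin n} (h : (i, k) ∈ S) (h' : (i, k') ∈ S) : k = k' :=
  congrArg Prod.snd (hS.2.1 _ h _ h' rfl)

theorem IsCol.eq_of_mem_position {n : ℕ} {S : Finset (Fin n × Fin n)} (hS : IsCol n S)
    {i i' k : Fin n} (h : (i, k) ∈ S) (h' : (i', k) ∈ S) : i = i' :=
  congrArg Prod.fst (hS.2.2 _ h _ h' rfl)

theorem sum_position_xval (n : ℕ) (y : Finset (Fin n × Fin n) → Fin n → ℝ) (i j : Fin n) :
    ∑ k, xval n y i j k = ∑ S ∈ univ.filter (fun S : Finset (Fin n × Fin n) =>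
      IsCol n S ∧ ∃ k : Fin n, (i, k) ∈ S), y S j := by
  simpa [xval] using sum_sum_isCol_mem (fun S => y S j) (fun k => (i, k)) (fun _ => True)
    fun _ hS _ _ => hS.eq_of_mem_client

theorem sum_client_filter_xval (n : ℕ) (y : Finset (Fin n × Fin n) → Fin n → ℝ) (j k : Fin n)
    (Q : Fin n → Prop) [DecidablePred Q] :
    ∑ i ∈ univ.filter Q, xval n y i j k = ∑ S ∈ univ.filter (fun S : Finset (Fin n × Fin n) =>
      IsCol n S ∧ ∃ i : Fin n, (i, k) ∈ S ∧ Q i), y S j :=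
  sum_sum_isCol_mem (fun S => y S j) (fun i => (i, k)) Q
    fun _ hS _ _ => hS.eq_of_mem_position

theorem sum_filter_xval (n : ℕ) (y : Finset (Fin n × Fin n) → Fin n → ℝ) (k : Fin n)
    (Q : Fin n × Fin n → Prop) [DecidablePred Q] :
    ∑ q ∈ univ.filter Q, xval n y q.1 q.2 k =
      ∑ j, ∑ S ∈ univ.filter (fun S : Finset (Fin n × Fin n) =>
        IsCol n S ∧ ∃ i : Fin n, (i, k) ∈ S ∧ Q (i, j)), y S j := by
  rw [sum_filter, Fintype.sum_prod_type_right]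
  refine sum_congr rfl fun j _ => ?_
  rw [← sum_client_filter_xval n y j k fun i => Q (i, j), sum_filter]

/-- A vector with entries at most `1` and sum at most `p ≤ card ι` can be raised, keeping its
entries at most `1`, so that its sum becomes `p`. -/
theorem exists_le_sum_eq {ι : Type*} [Fintype ι] (a : ι → ℝ) (p : ℝ) (ha : ∀ j, a j ≤ 1)
    (hap : ∑ j, a j ≤ p) (hp : p ≤ Fintype.card ι) :
    ∃ b : ι → ℝ, (∀ j, b j ≤ 1) ∧ (∀ j, a j ≤ b j) ∧ ∑ j, b j = p := by
  set Y := ∑ j, a j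
  set t := (p - Y) / (Fintype.card ι - Y)
  have ht0 : 0 ≤ t := div_nonneg (by linarith) (by linarith)
  have ht1 : t ≤ 1 := div_le_one_of_le₀ (by linarith) (by linarith)
  refine ⟨fun j => a j + t * (1 - a j), fun j => ?_, fun j => ?_, ?_⟩
  · nlinarith [ha j]
  · nlinarith [ha j]
  · have ht : t * (Fintype.card ι - Y) = p - Y := by
      rcases eq_or_ne ((Fintype.card ι : ℝ) - Y) 0 with h | h
      · rw [h]; linarith
      · exact div_mul_cancel₀ _ h
    rw [sum_add_distrib, ← mul_sum, sum_sub_distrib]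
    simp only [sum_const, card_univ, nsmul_eq_mul, mul_one]
    linarith

/-- If `y` satisfies (1ma)-(4ma) and the strong order constraints in the
`y` variables, then the induced `x` together with a suitable `ŷ ≥ ȳ` summing to `p`
satisfies (1fb), (2fb), (in1fb), (3fb) and the strong order constraints in the `x`
variables. -/
theorem statement5 (n p : ℕ) (hn : 1 ≤ n) (hp1 : 1 ≤ p) (hpn : p ≤ n)
    (r : Fin n × Fin n → Fin (n * n)) (hr : Function.Bijective r)
    (y : Finset (Fin n × Fin n) → Fin n → ℝ) (hb : YBounds n y)
    (h1 : C1ma n y) (h2 : C2ma n y) (h3 : C3ma n y) (h4 : C4ma n p y)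
    (hso : StrongOrderY n r y) :
    ∃ yhat : Fin n → ℝ,
      (∀ j : Fin n, 0 ≤ yhat j ∧ yhat j ≤ 1) ∧
      (∀ j : Fin n, (∑ S ∈ univ.filter (IsCol n), y S j) ≤ yhat j) ∧
      (∑ j : Fin n, yhat j = (p : ℝ)) ∧
      C1fb n (xval n y) ∧ C2fb n (xval n y) ∧ Cin1fb n (xval n y) yhat ∧
      StrongOrderX n r (xval n y) := by
  obtain ⟨yhat, hle, hge, hsum⟩ := exists_le_sum_eq
    (fun j => ∑ S ∈ univ.filter (IsCol n), y S j) p h3 h4 (by simpa using hpn)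
  have hnonneg : ∀ j, ∀ S ∈ univ.filter (IsCol n), 0 ≤ y S j := fun j S hS =>
    (hb S j (mem_filter.1 hS).2).1
  refine ⟨yhat, fun j => ⟨(sum_nonneg (hnonneg j)).trans (hge j), hle j⟩, hge, hsum, ?_, ?_, ?_, ?_⟩
  · intro i
    simpa only [sum_position_xval] using h1 i
  · intro k
    rw [sum_comm, ← h2 k]
    refine sum_congr rfl fun j _ => ?_
    simpa using sum_client_filter_xval n y j k fun _ => True
  · intro i j
    rw [sum_position_xval]
    refine le_trans (sum_le_sum_of_subset_of_nonneg ?_ fun S hS _ => hnonneg j S hS) (hge j)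
    exact monotone_filter_right _ fun S _ hS => hS.1
  · intro i j k hk
    rw [sum_filter_xval, sum_filter_xval]
    exact hso i j k hk

end DOMP
end

section
/- If the LP relaxation of MP is feasible, then the LP relaxation of WOC is feasible and its optimal value is at most the optimal value of the LP relaxation of MP. More precisely, for every y feasible for the LP relaxation of MP there exists (x, ŷ) feasible for the LP relaxation of WOC with Σ_{i,j,k} λ^k c_{ij} x_{ij}^k = Σ_{j} Σ_S c_S^j y_S^j; consequently the minimum of Σ_{i,j,k} λ^k c_{ij} x_{ij}^k over all (x, ŷ) feasible for the LP relaxation of WOC is less than or equal to the minimum of Σ_j Σ_S c_S^j y_S^j over all y feasible for the LP relaxation of MP. -/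
open Finset

namespace DOMP

/-- If `f` never hits a column twice, then the weight of the columns hit by `f` at some index
satisfying `P` splits as a sum over these indices. -/
theorem sum_columns_exists {n : ℕ} (f : Fin n → Fin n × Fin n)
    (hf : ∀ S, IsCol n S → ∀ a b, f a ∈ S → f b ∈ S → a = b)
    (P : Fin n → Prop) [DecidablePred P] (w : Finset (Fin n × Fin n) → ℝ) :
    ∑ S ∈ univ.filter (fun S : Finset (Fin n × Fin n) => IsCol n S ∧ ∃ a, f a ∈ S ∧ P a), w S =
      ∑ a ∈ univ.filter P,
        ∑ S ∈ univ.filter (fun S : Finset (Fin n × Fin n) => IsCol n S ∧ f a ∈ S), w S := by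
  rw [← sum_biUnion]
  · refine sum_congr ?_ fun _ _ => rfl
    ext S
    simp only [mem_filter, mem_univ, true_and, mem_biUnion]
    grind
  · intro a _ b _ hab
    refine disjoint_left.2 fun S hS hT => hab ?_
    simp only [mem_filter, mem_univ, true_and] at hS hT
    exact hf S hS.1 a b hS.2 hT.2

theorem sum_columns_position {n : ℕ} (y : Finset (Fin n × Fin n) → Fin n → ℝ) (j k : Fin n)
    (P : Fin n → Prop) [DecidablePred P] :
    ∑ S ∈ univ.filter (fun S : Finset (Fin n × Fin n) => IsCol n S ∧ ∃ i, (i, k) ∈ S ∧ P i),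
      y S j = ∑ i ∈ univ.filter P, xval n y i j k :=
  sum_columns_exists (fun i => (i, k))
    (fun _ hS _ _ ha hb => congrArg Prod.fst (hS.2.2 _ ha _ hb rfl)) P fun S => y S j

theorem sum_xval_client {n : ℕ} (y : Finset (Fin n × Fin n) → Fin n → ℝ) (j k : Fin n) :
    ∑ i, xval n y i j k =
      ∑ S ∈ univ.filter (fun S : Finset (Fin n × Fin n) => IsCol n S ∧ ∃ i, (i, k) ∈ S),
        y S j := by
  simpa using (sum_columns_position y j k fun _ => True).symm

theorem sum_xval_position {n : ℕ} (y : Finset (Fin n × Fin n) → Fin n → ℝ) (i j : Fin n) :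
    ∑ k, xval n y i j k =
      ∑ S ∈ univ.filter (fun S : Finset (Fin n × Fin n) => IsCol n S ∧ ∃ k, (i, k) ∈ S),
        y S j := by
  simpa [xval] using (sum_columns_exists (fun k => (i, k))
    (fun _ hS _ _ ha hb => congrArg Prod.snd (hS.2.1 _ ha _ hb rfl)) (fun _ => True)
    fun S => y S j).symm

theorem sum_xval_pairs {n : ℕ} (y : Finset (Fin n × Fin n) → Fin n → ℝ) (k : Fin n)
    (P : Fin n × Fin n → Prop) [DecidablePred P] :
    ∑ q ∈ univ.filter P, xval n y q.1 q.2 k =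
      ∑ j, ∑ S ∈ univ.filter (fun S : Finset (Fin n × Fin n) =>
        IsCol n S ∧ ∃ i, (i, k) ∈ S ∧ P (i, j)), y S j := by
  simp_rw [sum_columns_position, sum_filter]
  rw [Fintype.sum_prod_type, sum_comm]

theorem weakOrder_xval {n : ℕ} {r : Fin n × Fin n → Fin (n * n)}
    {y : Finset (Fin n × Fin n) → Fin n → ℝ} (h : C5ma n r y) : WeakOrder n r (xval n y) := by
  intro k hk
  simp_rw [sum_xval_pairs]
  exact h k hk

theorem objW_xval {n : ℕ} (c : Fin n → Fin n → ℝ) (lam : Fin n → ℝ)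
    (y : Finset (Fin n × Fin n) → Fin n → ℝ) : objW n c lam (xval n y) = objMP n c lam y := by
  unfold objW objMP colCost xval
  rw [sum_comm]
  refine sum_congr rfl fun j _ => ?_
  rw [← Fintype.sum_prod_type'
    (fun i k => lam k * c i j *
      ∑ S ∈ univ.filter (fun S : Finset (Fin n × Fin n) => IsCol n S ∧ (i, k) ∈ S), y S j)]
  simp_rw [mul_sum, sum_mul]
  refine sum_comm' fun q S => ?_
  simp [and_comm]

/-- A vector of `[0,1]` entries whose sum is at most `p ≤ card ι` can be increased within `[0,1]`
until its sum is exactly `p`. -/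
theorem exists_ge_sum_eq {ι : Type*} [Fintype ι] (u : ι → ℝ) (p : ℝ) (hu0 : ∀ j, 0 ≤ u j)
    (hu1 : ∀ j, u j ≤ 1) (hup : ∑ j, u j ≤ p) (hp : p ≤ Fintype.card ι) :
    ∃ v : ι → ℝ, (∀ j, 0 ≤ v j ∧ v j ≤ 1) ∧ (∀ j, u j ≤ v j) ∧ ∑ j, v j = p := by
  obtain hlt | heq := (hup.trans hp).lt_or_eq
  · have hd : 0 < (Fintype.card ι : ℝ) - ∑ j, u j := sub_pos.2 hlt
    obtain ⟨t, ht⟩ : ∃ t, t = (p - ∑ j, u j) / ((Fintype.card ι : ℝ) - ∑ j, u j) := ⟨_, rfl⟩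
    have ht0 : 0 ≤ t := ht ▸ div_nonneg (sub_nonneg.2 hup) hd.le
    have ht1 : t ≤ 1 := ht ▸ (div_le_one hd).2 (by linarith)
    have hle : ∀ j, u j ≤ u j + t * (1 - u j) := fun j =>
      le_add_of_nonneg_right (mul_nonneg ht0 (sub_nonneg.2 (hu1 j)))
    refine ⟨fun j => u j + t * (1 - u j), fun j => ⟨(hu0 j).trans (hle j), ?_⟩, hle, ?_⟩
    · nlinarith [hu1 j]
    · rw [sum_add_distrib, ← mul_sum, sum_sub_distrib]
      simp only [sum_const, card_univ, nsmul_eq_mul, mul_one]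
      rw [ht, div_mul_cancel₀ _ hd.ne']
      ring
  · exact ⟨u, fun j => ⟨hu0 j, hu1 j⟩, fun _ => le_rfl, le_antisymm hup (heq ▸ hp)⟩

theorem MPfeas.exists_WOCfeas_xval {n p : ℕ} (hpn : p ≤ n) {r : Fin n × Fin n → Fin (n * n)}
    {y : Finset (Fin n × Fin n) → Fin n → ℝ} (h : MPfeas n p r y) :
    ∃ yhat, WOCfeas n p r (xval n y) yhat := by
  obtain ⟨hb, h1, h2, h3, h4, h5⟩ := h
  have hpart : ∀ (Q : Finset (Fin n × Fin n) → Prop) [DecidablePred Q] (j : Fin n),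
      ∑ S ∈ univ.filter (fun S => IsCol n S ∧ Q S), y S j ≤
        ∑ S ∈ univ.filter (IsCol n), y S j := fun Q _ j =>
    sum_le_sum_of_subset_of_nonneg
      (fun S hS => by
        simp only [mem_filter, mem_univ, true_and] at hS ⊢
        exact hS.1)
      fun S hS _ => (hb S j (mem_filter.1 hS).2).1
  obtain ⟨yhat, hy, hge, hsum⟩ := exists_ge_sum_eq
    (fun j => ∑ S ∈ univ.filter (IsCol n), y S j) p
    (fun j => sum_nonneg fun S hS => (hb S j (mem_filter.1 hS).2).1) h3 h4
    (by simpa using hpn)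
  refine ⟨yhat, fun i j k => ⟨?_, ?_⟩, hy, fun i => ?_, fun k => ?_, fun i j => ?_, hsum,
    weakOrder_xval h5⟩
  · exact sum_nonneg fun S hS => (hb S j (mem_filter.1 hS).2.1).1
  · exact (hpart _ j).trans (h3 j)
  · simp_rw [sum_xval_position]
    exact h1 i
  · rw [sum_comm]
    simp_rw [sum_xval_client]
    exact h2 k
  · rw [sum_xval_position]
    exact (hpart _ j).trans (hge j)

theorem bddBelow_objW (n p : ℕ) (c : Fin n → Fin n → ℝ) (lam : Fin n → ℝ)
    (r : Fin n × Fin n → Fin (n * n)) :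
    BddBelow {v : ℝ | ∃ (x : Fin n → Fin n → Fin n → ℝ) (yhat : Fin n → ℝ),
      WOCfeas n p r x yhat ∧ v = objW n c lam x} := by
  refine ⟨∑ i, ∑ j, ∑ k, -|lam k * c i j|, ?_⟩
  rintro _ ⟨x, yhat, hx, rfl⟩
  refine sum_le_sum fun i _ => sum_le_sum fun j _ => sum_le_sum fun k _ => ?_
  obtain ⟨h0, h1⟩ := hx.1 i j k
  nlinarith [neg_abs_le (lam k * c i j), abs_nonneg (lam k * c i j)]

/-- If the LP relaxation of MP is feasible then so is the LP relaxation
of WOC: every MP-feasible `y` has a WOC-feasible image with the same objective value, and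
consequently the optimal value of the LP relaxation of WOC is at most that of MP. -/
theorem statement7 (n p : ℕ) (hn : 1 ≤ n) (hp1 : 1 ≤ p) (hpn : p ≤ n)
    (c : Fin n → Fin n → ℝ) (lam : Fin n → ℝ) (hlam : ∀ k : Fin n, 0 ≤ lam k)
    (r : Fin n × Fin n → Fin (n * n)) (hr : Function.Bijective r)
    (hrc : ∀ a b : Fin n × Fin n, r a < r b → c a.1 a.2 ≤ c b.1 b.2)
    (hfeas : ∃ y : Finset (Fin n × Fin n) → Fin n → ℝ, MPfeas n p r y) :
    (∀ y : Finset (Fin n × Fin n) → Fin n → ℝ, MPfeas n p r y →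
      ∃ (x : Fin n → Fin n → Fin n → ℝ) (yhat : Fin n → ℝ),
        WOCfeas n p r x yhat ∧ objW n c lam x = objMP n c lam y) ∧
    sInf {v : ℝ | ∃ (x : Fin n → Fin n → Fin n → ℝ) (yhat : Fin n → ℝ),
        WOCfeas n p r x yhat ∧ v = objW n c lam x}
      ≤ sInf {v : ℝ | ∃ y : Finset (Fin n × Fin n) → Fin n → ℝ,
        MPfeas n p r y ∧ v = objMP n c lam y} := by
  have himage : ∀ y, MPfeas n p r y → ∃ (x : Fin n → Fin n → Fin n → ℝ) (yhat : Fin n → ℝ),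
      WOCfeas n p r x yhat ∧ objW n c lam x = objMP n c lam y := fun y hy => by
    obtain ⟨yhat, h⟩ := hy.exists_WOCfeas_xval hpn
    exact ⟨xval n y, yhat, h, objW_xval c lam y⟩
  refine ⟨himage, csInf_le_csInf (bddBelow_objW n p c lam r) ?_ ?_⟩
  · obtain ⟨y, hy⟩ := hfeas
    exact ⟨_, y, hy, rfl⟩
  · rintro _ ⟨y, hy, rfl⟩
    obtain ⟨x, yhat, hx, hobj⟩ := himage y hy
    exact ⟨x, yhat, hx, hobj.symm⟩

end DOMP
end
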